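/- arXiv:1809.07383 — 2 statements merged into one kernel-verified Lean document; each statement's English description precedes it below -/
import Mathlib

section
/- If each action set Ω_i is a nonempty compact convex subset of ℝ and the game mapping F is continuous, then the game Γ has at least one Nash equilibrium, and every Nash equilibrium x* satisfies ⟨F(x*), x − x*⟩ ≥ 0 for all x ∈ Ω. -/
/-- `x` is a Nash equilibrium of the game with action sets `Ω i ⊆ ℝ` and costs `J i`. -/
def IsNashEq {n : ℕ} (Ω : Fin n → Set ℝ) (J : Fin n → (Fin n → ℝ) → ℝ) (x : Fin n → ℝ) : Prop :=
  (∀ i, x i ∈ Ω i) ∧ ∀ i : Fin n, ∀ t ∈ Ω i, J i x ≤ J i (Function.update x i t)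

/-- A set `P` is undominated for the rankings `r` if no element ranks strictly above some member
of `P` in every ranking at once. -/
def Undominated {Y I α : Type*} [LinearOrder α] (r : I → Y → α) (P : Finset Y) : Prop :=
  ∀ z, ∃ i, ∀ p ∈ P, r i z ≤ r i p

theorem Undominated.mono {Y I α : Type*} [LinearOrder α] {r : I → Y → α} {P E : Finset Y}
    (hP : Undominated r P) (h : E ⊆ P) : Undominated r E := fun z => by
  obtain ⟨i, hi⟩ := hP z
  exact ⟨i, fun p hp => hi p (h hp)⟩

theorem Finset.exists_insert_eq_of_subset_of_card {Y : Type*} [DecidableEq Y] {E P : Finset Y}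
    (h : E ⊆ P) (hc : P.card = E.card + 1) : ∃ w ∉ E, insert w E = P :=
  Finset.covBy_iff_exists_insert.1 (Finset.covBy_iff_card_sdiff_eq_one.2
    ⟨h, by rw [Finset.card_sdiff_of_subset h]; omega⟩)

section Scarf

variable {Y I α : Type*} [Fintype Y] [DecidableEq Y] [Fintype I] [DecidableEq I] [LinearOrder α]
  {r : I → Y → α}

open Classical in
/-- An undominated set with one element fewer than there are rankings, some member of which is
ranked below all slack elements `s t` (except in the ranking `t`), extends in exactly two ways to
an undominated set with as many elements as there are rankings. -/
theorem card_undominated_extensions_eq_two (hr : ∀ i, Function.Injective (r i)) {s : I → Y}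
    {E : Finset Y} (hE : Undominated r E) (hcard : E.card + 1 = Fintype.card I)
    {x : Y} (hxE : x ∈ E) (hx : ∀ i t, i ≠ t → r i x < r i (s t)) :
    (Finset.univ.filter fun P : Finset Y =>
      (Undominated r P ∧ P.card = Fintype.card I) ∧ E ⊆ P).card = 2 := by
  choose m hmE hm using fun i => Finset.exists_min_image E (r i) ⟨x, hxE⟩
  have m_eq : ∀ i, ∀ e ∈ E, (∀ p ∈ E, r i e ≤ r i p) → m i = e := fun i e he h =>
    hr i (le_antisymm (hm i e he) (h _ (hmE i)))
  obtain ⟨a, -, b, -, hab, hmab⟩ : ∃ a ∈ Finset.univ, ∃ b ∈ (Finset.univ : Finset I),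
      a ≠ b ∧ m a = m b :=
    Finset.exists_ne_map_eq_of_card_lt_of_maps_to (t := E)
      (by rw [Finset.card_univ]; omega) (fun i _ => hmE i)
  have inj : ∀ t t', t ≠ t' → m t = m t' → ∀ i j, i ≠ t → j ≠ t → m i = m j → i = j := by
    intro t t' htt' hmt i j hi hj hij
    have hsurj : Set.SurjOn m (Finset.univ.erase t : Finset I) (E : Set Y) := by
      intro e he
      obtain ⟨k, hk⟩ := hE e
      have hke := m_eq k e he hk
      by_cases hkt : k = t
      · exact ⟨t', by simp [htt'.symm], by rw [← hmt, ← hkt, hke]⟩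
      · exact ⟨k, by simp [hkt], hke⟩
    exact Finset.injOn_of_surjOn_of_card_le m (fun k _ => hmE k) hsurj
      (by rw [Finset.card_erase_of_mem (Finset.mem_univ t), Finset.card_univ]; omega)
      (by simpa using hi) (by simpa using hj) hij
  have ab : ∀ i j, i ≠ j → m i = m j → i = a ∨ i = b := by
    intro i j hij h
    by_contra! hcon
    by_cases hja : j = a
    · exact hij (inj b a hab.symm hmab.symm i j hcon.2 (hja ▸ hab) h)
    · exact hij (inj a b hab hmab i j hcon.1 hja h)
  have hS : ∀ t, ∃ y, (∀ i, i ≠ t → r i (m i) < r i y) ∧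
      ∀ z, (∀ i, i ≠ t → r i (m i) < r i z) → r t z ≤ r t y := by
    intro t
    obtain ⟨y, hy, hmax⟩ := Finset.exists_max_image
      (Finset.univ.filter fun z => ∀ i, i ≠ t → r i (m i) < r i z) (r t)
      ⟨s t, by simpa using fun i hi => (hm i x hxE).trans_lt (hx i t hi)⟩
    exact ⟨y, by simpa using hy, fun z hz => hmax z (by simpa using hz)⟩
  choose y hyS hymax using hS
  have notMem : ∀ t t', t ≠ t' → m t = m t' → y t ∉ E := by
    intro t t' htt' hmt hyE
    obtain ⟨i, hi⟩ := hE (y t)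
    have hiy := m_eq i _ hyE hi
    by_cases hit : i = t
    · have := hyS t t' htt'.symm
      rw [← hmt, ← hit, hiy] at this
      exact lt_irrefl _ (hit ▸ this)
    · exact lt_irrefl _ (hiy ▸ hyS t i hit)
  have undom : ∀ t, Undominated r (insert (y t) E) := by
    intro t z
    by_cases hz : ∀ i, i ≠ t → r i (m i) < r i z
    · obtain ⟨i, hi⟩ := hE z
      have hit : i = t := by
        by_contra h
        exact absurd (hz i h) (not_lt.2 (hi _ (hmE i)))
      subst hit
      refine ⟨i, fun p hp => ?_⟩
      rcases Finset.mem_insert.1 hp with rfl | hp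
      · exact hymax i z hz
      · exact hi p hp
    · push Not at hz
      obtain ⟨i, hit, hi⟩ := hz
      refine ⟨i, fun p hp => ?_⟩
      rcases Finset.mem_insert.1 hp with rfl | hp
      · exact hi.trans (hyS t i hit).le
      · exact hi.trans (hm i p hp)
  have uniq : ∀ w, w ∉ E → Undominated r (insert w E) → w = y a ∨ w = y b := by
    intro w hwE hw
    obtain ⟨t, ht⟩ := hw w
    have key : ∀ e ∈ E, ∃ j, j ≠ t ∧ m j = e ∧ r j e < r j w := by
      intro e he
      obtain ⟨j, hj⟩ := hw e
      have hne : r j e ≠ r j w := fun h => hwE (hr j h ▸ he)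
      have hlt := lt_of_le_of_ne (hj w (Finset.mem_insert_self _ _)) hne
      refine ⟨j, ?_, m_eq j e he fun p hp => hj p (Finset.mem_insert_of_mem hp), hlt⟩
      rintro rfl
      exact absurd hlt (not_lt.2 (ht e (Finset.mem_insert_of_mem he)))
    obtain ⟨j, hjt, hj, -⟩ := key (m t) (hmE t)
    have hwt : w = y t := by
      have hwS : ∀ i, i ≠ t → r i (m i) < r i w := by
        intro i hi
        obtain ⟨k, hkt, hk, hlt⟩ := key (m i) (hmE i)
        obtain rfl := inj t j hjt.symm hj.symm i k hi hkt hk.symm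
        exact hlt
      refine hr t (le_antisymm (hymax t w hwS) ?_)
      obtain ⟨i, hi⟩ := hw (y t)
      by_cases hit : i = t
      · subst hit
        exact hi w (Finset.mem_insert_self _ _)
      · exact absurd (hyS t i hit) (not_lt.2 (hi _ (Finset.mem_insert_of_mem (hmE i))))
    rcases ab t j hjt.symm hj.symm with rfl | rfl
    · exact Or.inl hwt
    · exact Or.inr hwt
  have hyab : y a ≠ y b := by
    intro h
    obtain ⟨i, hi⟩ := hE (y a)
    refine absurd (hi _ (hmE i)) (not_le.2 ?_)
    by_cases hia : i = a
    · rw [h]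
      exact hyS b i (hia ▸ hab)
    · exact hyS a i hia
  have hya := notMem a b hab hmab
  have hyb := notMem b a hab.symm hmab.symm
  refine Finset.card_eq_two.2 ⟨insert (y a) E, insert (y b) E, ?_, ?_⟩
  · intro h
    have : y a ∈ insert (y b) E := h ▸ Finset.mem_insert_self _ _
    rcases Finset.mem_insert.1 this with h | h
    exacts [hyab h, hya h]
  · ext P
    simp only [Finset.mem_filter, Finset.mem_univ, true_and, Finset.mem_insert,
      Finset.mem_singleton]
    constructor
    · rintro ⟨⟨hP, hPc⟩, hEP⟩
      obtain ⟨w, hw, rfl⟩ := Finset.exists_insert_eq_of_subset_of_card hEP (by omega)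
      rcases uniq w hw hP with rfl | rfl
      exacts [Or.inl rfl, Or.inr rfl]
    · rintro (rfl | rfl)
      · exact ⟨⟨undom a, by rw [Finset.card_insert_of_notMem hya, hcard]⟩,
          Finset.subset_insert _ _⟩
      · exact ⟨⟨undom b, by rw [Finset.card_insert_of_notMem hyb, hcard]⟩,
          Finset.subset_insert _ _⟩

theorem even_card_almost_rainbow_subsets (c : Y → I) (i₀ : I) {P : Finset Y}
    (hP : P.card = Fintype.card I) (hc : P.image c ≠ Finset.univ) :
    Even (Finset.univ.filter fun E : Finset Y =>
      (E.card + 1 = Fintype.card I ∧ E.image c = Finset.univ.erase i₀) ∧ E ⊆ P).card := by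
  rcases Finset.eq_empty_or_nonempty (Finset.univ.filter fun E : Finset Y =>
      (E.card + 1 = Fintype.card I ∧ E.image c = Finset.univ.erase i₀) ∧ E ⊆ P) with h | ⟨E, hE⟩
  · simp [h]
  simp only [Finset.mem_filter, Finset.mem_univ, true_and] at hE
  obtain ⟨⟨hEc, hEi⟩, hEP⟩ := hE
  obtain ⟨y, hy, rfl⟩ := Finset.exists_insert_eq_of_subset_of_card hEP (by omega)
  have hinj : Set.InjOn c E := Finset.card_image_iff.1 (by
    rw [hEi, Finset.card_erase_of_mem (Finset.mem_univ _), Finset.card_univ]; omega)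
  have hcy : c y ≠ i₀ := by
    rintro h
    rw [Finset.image_insert, hEi, h, Finset.insert_erase (Finset.mem_univ _)] at hc
    exact hc rfl
  obtain ⟨x, hxE, hxy⟩ : ∃ x ∈ E, c x = c y := by
    rw [← Finset.mem_image, hEi]
    simpa using hcy
  have hne : y ≠ x := fun h => hy (h ▸ hxE)
  have hyE' : y ∉ E.erase x := fun h => hy (Finset.mem_of_mem_erase h)
  refine even_iff_two_dvd.2 (dvd_of_eq (Eq.symm (Finset.card_eq_two.2
    ⟨E, insert y (E.erase x), ?_, ?_⟩)))
  · exact fun h => hy (h ▸ Finset.mem_insert_self _ _)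
  · ext D
    simp only [Finset.mem_filter, Finset.mem_univ, true_and, Finset.mem_insert,
      Finset.mem_singleton]
    constructor
    · rintro ⟨⟨hDc, hDi⟩, hDP⟩
      by_cases hyD : y ∈ D
      · right
        have hDinj : Set.InjOn c D := Finset.card_image_iff.1 (by
          rw [hDi, Finset.card_erase_of_mem (Finset.mem_univ _), Finset.card_univ]; omega)
        refine Finset.eq_of_subset_of_card_le (fun z hz => ?_) ?_
        · rcases Finset.mem_insert.1 (hDP hz) with rfl | hzE
          · exact Finset.mem_insert_self _ _
          · refine Finset.mem_insert_of_mem (Finset.mem_erase.2 ⟨?_, hzE⟩)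
            rintro rfl
            exact hne (hDinj hyD hz hxy.symm)
        · rw [Finset.card_insert_of_notMem hyE', Finset.card_erase_of_mem hxE]
          have := Finset.card_pos.2 ⟨x, hxE⟩
          omega
      · left
        refine Finset.eq_of_subset_of_card_le (fun z hz => ?_) (by omega)
        rcases Finset.mem_insert.1 (hDP hz) with rfl | hzE
        exacts [absurd hz hyD, hzE]
    · rintro (rfl | rfl)
      · exact ⟨⟨hEc, hEi⟩, hEP⟩
      · refine ⟨⟨?_, ?_⟩, Finset.insert_subset_insert _ (Finset.erase_subset _ _)⟩
        · rw [Finset.card_insert_of_notMem hyE', Finset.card_erase_of_mem hxE]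
          have := Finset.card_pos.2 ⟨x, hxE⟩
          omega
        · rw [← hEi, Finset.image_insert, ← hxy, ← Finset.image_insert,
            Finset.insert_erase hxE]

/-- **Scarf's lemma** with slack elements `s i`: any colouring of a ranked finite set in which
`s i` has colour `i` admits an undominated set carrying each colour exactly once. -/
theorem exists_undominated_rainbow [Nonempty I] (hr : ∀ i, Function.Injective (r i)) {s : I → Y}
    (hs : ∀ i y, r i (s i) ≤ r i y)
    (hs' : ∀ i t, i ≠ t → ∀ y ∉ Set.range s, r i y < r i (s t))
    (hY : ∃ y, y ∉ Set.range s) (c : Y → I) (hc : ∀ i, c (s i) = i) :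
    ∃ P : Finset Y, Undominated r P ∧ P.card = Fintype.card I ∧ P.image c = Finset.univ := by
  classical
  by_contra! hcon
  obtain ⟨i₀⟩ := ‹Nonempty I›
  have hsinj : Function.Injective s := Function.LeftInverse.injective hc
  set rooms := Finset.univ.filter fun P : Finset Y => Undominated r P ∧ P.card = Fintype.card I
    with hrooms
  set doors := Finset.univ.filter fun E : Finset Y =>
    E.card + 1 = Fintype.card I ∧ E.image c = Finset.univ.erase i₀ with hdoors
  set E₀ : Finset Y := (Finset.univ.erase i₀).image s with hE₀
  have hE₀c : E₀.card + 1 = Fintype.card I := by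
    rw [hE₀, Finset.card_image_of_injective _ hsinj,
      Finset.card_erase_of_mem (Finset.mem_univ _), Finset.card_univ]
    have : 0 < Fintype.card I := Fintype.card_pos_iff.2 ⟨i₀⟩
    omega
  have hE₀mem : E₀ ∈ doors := by
    simp only [hdoors, Finset.mem_filter, Finset.mem_univ, true_and]
    refine ⟨hE₀c, ?_⟩
    rw [hE₀, Finset.image_image]
    simp [Function.comp_def, hc]
  have one : (rooms.filter fun P => E₀ ⊆ P).card = 1 := by
    obtain ⟨y₀, hy₀⟩ := hY
    obtain ⟨w, hw, hwmax⟩ := Finset.exists_max_image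
      (Finset.univ.filter fun y => y ∉ Set.range s) (r i₀) ⟨y₀, by simpa using hy₀⟩
    replace hw : w ∉ Set.range s := (Finset.mem_filter.1 hw).2
    replace hwmax : ∀ z ∉ Set.range s, r i₀ z ≤ r i₀ w := fun z hz =>
      hwmax z (Finset.mem_filter.2 ⟨Finset.mem_univ _, hz⟩)
    have hE₀r : ∀ y ∈ E₀, ∃ t, t ≠ i₀ ∧ s t = y := by
      intro y hy
      simpa [hE₀] using hy
    have hwE : w ∉ E₀ := fun h => by
      obtain ⟨t, -, rfl⟩ := hE₀r w h
      exact hw ⟨t, rfl⟩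
    refine Finset.card_eq_one.2 ⟨insert w E₀, ?_⟩
    ext P
    simp only [hrooms, Finset.mem_filter, Finset.mem_univ, true_and, Finset.mem_singleton]
    constructor
    · rintro ⟨⟨hP, hPc⟩, hEP⟩
      obtain ⟨y, hy, rfl⟩ := Finset.exists_insert_eq_of_subset_of_card hEP (by omega)
      have dom : ∀ z ∉ Set.range s, r i₀ z ≤ r i₀ y := by
        intro z hz
        obtain ⟨i, hi⟩ := hP z
        by_cases hii : i = i₀
        · exact hii ▸ hi y (Finset.mem_insert_self _ _)
        · have := hi (s i) (Finset.mem_insert_of_mem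
            (Finset.mem_image_of_mem _ (by simpa using hii)))
          exact absurd ⟨i, hr i (le_antisymm (hs i z) this)⟩ hz
      have hyr : y ∉ Set.range s := by
        rintro ⟨t, rfl⟩
        by_cases hti : t = i₀
        · subst hti
          exact hw ⟨t, hr t (le_antisymm (hs t w) (dom w hw))⟩
        · exact hy (Finset.mem_image_of_mem _ (by simpa using hti))
      rw [hr i₀ (le_antisymm (hwmax y hyr) (dom w hw))]
    · rintro rfl
      refine ⟨⟨fun z => ?_, by rw [Finset.card_insert_of_notMem hwE, hE₀c]⟩,
        Finset.subset_insert _ _⟩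
      by_cases hz : z ∈ Set.range s
      · obtain ⟨i, rfl⟩ := hz
        exact ⟨i, fun p _ => hs i p⟩
      · refine ⟨i₀, fun p hp => ?_⟩
        rcases Finset.mem_insert.1 hp with rfl | hp
        · exact hwmax z hz
        · obtain ⟨t, ht, rfl⟩ := hE₀r p hp
          exact (hs' i₀ t ht.symm z hz).le
  have two : ∀ E ∈ doors.erase E₀, Even (rooms.filter fun P => E ⊆ P).card := by
    intro E hE
    simp only [hdoors, Finset.mem_erase, Finset.mem_filter, Finset.mem_univ, true_and] at hE
    obtain ⟨hne, hEc, hEi⟩ := hE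
    rcases Finset.eq_empty_or_nonempty (rooms.filter fun P => E ⊆ P) with h | ⟨P, hP⟩
    · simp [h]
    simp only [hrooms, Finset.mem_filter, Finset.mem_univ, true_and] at hP
    obtain ⟨x, hxE, hx⟩ : ∃ x ∈ E, x ∉ Set.range s := by
      by_contra! h
      refine hne (Finset.eq_of_subset_of_card_le (fun y hy => ?_) (by omega))
      obtain ⟨t, rfl⟩ := h y hy
      have := Finset.mem_image_of_mem c hy
      rw [hEi, hc] at this
      exact Finset.mem_image_of_mem _ this
    have := card_undominated_extensions_eq_two hr (s := s) (hP.1.1.mono hP.2) hEc hxE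
      fun i t hit => hs' i t hit x hx
    rw [hrooms, Finset.filter_filter, this]
    exact even_two
  have count := Finset.sum_card_bipartiteAbove_eq_sum_card_bipartiteBelow
    (s := doors) (t := rooms) (fun E P => E ⊆ P)
  have heven : Even (∑ P ∈ rooms, (doors.filter fun E => E ⊆ P).card) := by
    refine Finset.even_sum _ fun P hP => ?_
    simp only [hrooms, Finset.mem_filter, Finset.mem_univ, true_and] at hP
    rw [hdoors, Finset.filter_filter]
    exact even_card_almost_rainbow_subsets c i₀ hP.2 (hcon P hP.1 hP.2)
  have hodd : Odd (∑ E ∈ doors, (rooms.filter fun P => E ⊆ P).card) := by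
    rw [← Finset.add_sum_erase _ _ hE₀mem, one, add_comm]
    exact (Finset.even_sum _ two).add_one
  exact Nat.not_even_iff_odd.2 hodd (count ▸ heven)

end Scarf

/-- A colouring of the lattice points of the dilated simplex admits, for every colour `i`, a lattice
point that has colour `i` or a small `i`-th coordinate, all of them close to one another. -/
theorem exists_close_rainbow_lattice_points {I : Type*} [Fintype I] [DecidableEq I] [Nonempty I]
    (N : ℕ) (c : (I → ℕ) → I) :
    ∃ x : I → I → ℕ, (∀ i, ∑ k, x i k = N) ∧
      (∀ i j k, x i k ≤ x j k + Fintype.card I) ∧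
      ∀ i, c (x i) = i ∨ x i i ≤ Fintype.card I := by
  classical
  let X := {x : I → ℕ // x ∈ Finset.piAntidiag Finset.univ N}
  let _ : Fintype X := Finset.Subtype.fintype _
  have hX : ∀ x : X, ∑ k, x.1 k = N := fun x => (Finset.mem_piAntidiag.1 x.2).1
  have hXle : ∀ (x : X) k, x.1 k ≤ N := fun x k =>
    (Finset.single_le_sum (f := x.1) (fun _ _ => Nat.zero_le _) (Finset.mem_univ k)).trans_eq (hX x)
  let mk : ∀ x : I → ℕ, ∑ k, x k = N → X := fun x hx =>
    ⟨x, Finset.mem_piAntidiag.2 ⟨hx, fun _ _ => Finset.mem_univ _⟩⟩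
  let f : I → X ⊕ I → ℤ := fun i =>
    Sum.elim (fun x => (x.1 i : ℤ)) (fun j => if j = i then -1 else N + 1)
  let e := Fintype.equivFin (X ⊕ I)
  let r : I → X ⊕ I → ℤ ×ₗ Fin (Fintype.card (X ⊕ I)) := fun i y => toLex (f i y, e y)
  have hr : ∀ i, Function.Injective (r i) := fun i y z h =>
    e.injective (congrArg (fun p => (ofLex p).2) h)
  have r_lt : ∀ i y z, f i y < f i z → r i y < r i z := fun i y z h =>
    Prod.Lex.toLex_lt_toLex.2 (Or.inl h)
  have f_le : ∀ i y z, r i y ≤ r i z → f i y ≤ f i z := fun i y z h => by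
    by_contra! hlt
    exact absurd (r_lt i z y hlt) (not_lt.2 h)
  obtain ⟨i₀⟩ := ‹Nonempty I›
  let x₀ : X := mk (Pi.single i₀ N) (by simp)
  obtain ⟨P, hP, hPc, hPi⟩ := exists_undominated_rainbow (r := r) (s := Sum.inr) hr
    (by
      rintro i (x | j)
      · refine (r_lt _ _ _ ?_).le
        simp only [f, Sum.elim_inl, Sum.elim_inr, if_true]
        omega
      · by_cases hj : j = i
        · rw [hj]
        · refine (r_lt _ _ _ ?_).le
          simp only [f, Sum.elim_inr, if_true, if_neg hj]
          omega)
    (by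
      rintro i t hit (x | j) hy
      · refine r_lt _ _ _ ?_
        have := hXle x i
        simp only [f, Sum.elim_inl, Sum.elim_inr, if_neg hit.symm]
        omega
      · exact absurd ⟨j, rfl⟩ hy)
    ⟨Sum.inl x₀, by simp⟩
    (Sum.elim (fun x => c x.1) id) (fun i => rfl)
  have hslack : ∀ i, Sum.inr i ∈ P → ∀ z : X, ¬ ∀ p ∈ P, r i (Sum.inl z) ≤ r i p := by
    intro i hi z h
    have := f_le _ _ _ (h _ hi)
    simp only [f, Sum.elim_inl, Sum.elim_inr, if_true] at this
    omega
  have hcol : ∀ i, Sum.inr i ∉ P → ∃ x : X, Sum.inl x ∈ P ∧ c x.1 = i := by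
    intro i hi
    obtain ⟨y, hy, hyi⟩ := Finset.mem_image.1 (hPi ▸ Finset.mem_univ i)
    rcases y with x | j
    · exact ⟨x, hy, hyi⟩
    · exact absurd (show j = i from hyi ▸ rfl) (fun h => hi (h ▸ hy))
  have hdom : ∀ z : X, ∃ i, Sum.inr i ∉ P ∧ ∀ x : X, Sum.inl x ∈ P → z.1 i ≤ x.1 i := by
    intro z
    obtain ⟨i, hi⟩ := hP (Sum.inl z)
    refine ⟨i, fun h => hslack i h z hi, fun x hx => ?_⟩
    have := f_le _ _ _ (hi _ hx)
    simpa [f] using this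
  obtain ⟨i₁, hi₁, -⟩ := hdom x₀
  obtain ⟨x₁, hx₁, -⟩ := hcol i₁ hi₁
  set C := Finset.univ.filter fun i : I => Sum.inr i ∉ P with hC
  choose m hmP hm using fun k : I => Finset.exists_min_image
    (Finset.univ.filter fun x : X => Sum.inl x ∈ P) (fun x => x.1 k) ⟨x₁, by simpa using hx₁⟩
  replace hm : ∀ k, ∀ x : X, Sum.inl x ∈ P → (m k).1 k ≤ x.1 k := fun k x hx =>
    hm k x (by simpa using hx)
  replace hmP : ∀ k, Sum.inl (m k) ∈ P := fun k => by simpa using hmP k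
  have hsum : N < ∑ k ∈ C, ((m k).1 k + 1) := by
    by_contra! hle
    let z : I → ℕ := fun k => (if k ∈ C then (m k).1 k + 1 else 0) +
      if k = i₁ then N - ∑ k ∈ C, ((m k).1 k + 1) else 0
    have hz : ∑ k, z k = N := by
      simp only [z, Finset.sum_add_distrib, Finset.sum_ite_mem, Finset.univ_inter,
        Finset.sum_ite_eq', Finset.mem_univ, if_true] at hle ⊢
      omega
    obtain ⟨i, hi, hdi⟩ := hdom (mk z hz)
    have h₁ : z i ≤ (m i).1 i := hdi _ (hmP i)
    have h₂ : i ∈ C := by simpa [hC] using hi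
    simp only [z, if_pos h₂] at h₁
    omega
  have hCle : C.card ≤ Fintype.card I := Finset.card_le_univ C
  rw [Finset.sum_add_distrib, Finset.sum_const, smul_eq_mul, mul_one] at hsum
  have upper : ∀ x : X, Sum.inl x ∈ P → ∀ k,
      x.1 k ≤ (if k ∈ C then (m k).1 k else 0) + Fintype.card I := by
    intro x hx k
    have h₁ := hX x
    rw [← Finset.add_sum_erase _ _ (Finset.mem_univ k)] at h₁
    have h₂ : ∑ j ∈ C.erase k, (m j).1 j ≤ ∑ j ∈ Finset.univ.erase k, x.1 j :=
      (Finset.sum_le_sum fun j _ => hm j x hx).trans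
        (Finset.sum_le_sum_of_subset (Finset.erase_subset_erase _ (Finset.subset_univ _)))
    split_ifs with hk
    · rw [← Finset.add_sum_erase _ _ hk] at hsum
      omega
    · rw [Finset.erase_eq_of_notMem hk] at h₂
      omega
  have close : ∀ x y : X, Sum.inl x ∈ P → Sum.inl y ∈ P → ∀ k,
      x.1 k ≤ y.1 k + Fintype.card I := by
    intro x y hx hy k
    have h₁ := upper x hx k
    have h₂ := hm k y hy
    split_ifs at h₁ <;> omega
  have pts : ∀ i, ∃ x : X, Sum.inl x ∈ P ∧ (c x.1 = i ∨ x.1 i ≤ Fintype.card I) := by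
    intro i
    by_cases hi : Sum.inr i ∈ P
    · refine ⟨x₁, hx₁, Or.inr ?_⟩
      have hiC : i ∉ C := by simpa [hC] using hi
      simpa [hiC] using upper x₁ hx₁ i
    · obtain ⟨x, hx, hxi⟩ := hcol i hi
      exact ⟨x, hx, Or.inl hxi⟩
  choose x hxP hxc using pts
  exact ⟨fun i => (x i).1, fun i => hX _, fun i j k => close _ _ (hxP i) (hxP j) k, hxc⟩

open Filter Topology in
/-- **Brouwer's fixed point theorem** on the standard simplex. -/
theorem exists_fixed_point_stdSimplex {I : Type*} [Fintype I] [Nonempty I]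
    {f : (I → ℝ) → I → ℝ} (hf : Continuous f)
    (hmaps : Set.MapsTo f (stdSimplex ℝ I) (stdSimplex ℝ I)) :
    ∃ x ∈ stdSimplex ℝ I, f x = x := by
  classical
  set K : ℝ := (Fintype.card I : ℝ) with hK
  have eq_of_le : ∀ x ∈ stdSimplex ℝ I, (∀ i, x i ≤ f x i) → f x = x := by
    intro x hx hle
    have hsum : ∑ i, x i = ∑ i, f x i := by rw [hx.2, (hmaps hx).2]
    exact funext fun i =>
      ((Finset.sum_eq_sum_iff_of_le fun i _ => hle i).1 hsum i (Finset.mem_univ i)).symm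
  have exists_le : ∀ x ∈ stdSimplex ℝ I, ∃ i, x i ≤ f x i := by
    intro x hx
    by_contra! h
    have := Finset.sum_lt_sum_of_nonempty Finset.univ_nonempty fun i _ => h i
    rw [hx.2, (hmaps hx).2] at this
    exact lt_irrefl _ this
  have approx : ∀ N : ℕ, ∃ x : I → I → ℝ, (∀ i, x i ∈ stdSimplex ℝ I) ∧
      (∀ i j k, x i k ≤ x j k + K / (N + 1 : ℕ)) ∧
      ∀ i, x i i ≤ f (x i) i + K / (N + 1 : ℕ) := by
    intro N
    let p : (I → ℕ) → I → ℝ := fun x k => (x k : ℝ) / (N + 1 : ℕ)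
    have hN : (0 : ℝ) < (N + 1 : ℕ) := by positivity
    have hp : ∀ x : I → ℕ, ∑ k, x k = N + 1 → p x ∈ stdSimplex ℝ I := by
      refine fun x hx => ⟨fun k => by positivity, ?_⟩
      simp only [p]
      rw [← Finset.sum_div, ← Nat.cast_sum, hx, div_self hN.ne']
    have hc : ∀ x : I → ℕ, ∃ i, ∑ k, x k = N + 1 → p x i ≤ f (p x) i := by
      intro x
      by_cases hx : ∑ k, x k = N + 1
      · exact (exists_le _ (hp x hx)).imp fun i hi _ => hi
      · exact ⟨Classical.arbitrary I, fun h => absurd h hx⟩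
    choose c hc using hc
    obtain ⟨x, hxN, hclose, hcol⟩ := exists_close_rainbow_lattice_points (N + 1) c
    refine ⟨fun i => p (x i), fun i => hp _ (hxN i), fun i j k => ?_, fun i => ?_⟩
    · simp only [p, hK]
      rw [← add_div]
      gcongr
      exact_mod_cast hclose i j k
    · rcases hcol i with h | h
      · have := hc (x i) (hxN i)
        rw [h] at this
        exact this.trans (le_add_of_nonneg_right (by positivity))
      · have h₁ : p (x i) i ≤ K / (N + 1 : ℕ) := by
          simp only [p, hK]
          gcongr
        have h₂ := (hmaps (hp _ (hxN i))).1 i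
        linarith
  choose x hx hclose hle using approx
  let i₀ := Classical.arbitrary I
  obtain ⟨y, hy, φ, hφ, hlim⟩ := (isCompact_stdSimplex ℝ I).tendsto_subseq fun N => hx N i₀
  have hε : Tendsto (fun N => K / (φ N + 1 : ℕ)) atTop (𝓝 0) :=
    ((tendsto_const_div_atTop_nhds_zero_nat K).comp (tendsto_add_atTop_nat 1)).comp
      hφ.tendsto_atTop
  have hlim' : ∀ i, Tendsto (fun N => x (φ N) i) atTop (𝓝 y) := by
    intro i
    rw [tendsto_pi_nhds] at hlim ⊢
    intro k
    have h₁ := (hlim k).sub hε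
    have h₂ := (hlim k).add hε
    rw [sub_zero] at h₁
    rw [add_zero] at h₂
    refine tendsto_of_tendsto_of_tendsto_of_le_of_le h₁ h₂ (fun N => ?_) fun N => ?_
    · exact sub_le_iff_le_add.2 (hclose (φ N) i₀ i k)
    · exact hclose (φ N) i i₀ k
  refine ⟨y, hy, eq_of_le y hy fun i => ?_⟩
  have h₁ := (tendsto_pi_nhds.1 (hlim' i)) i
  have h₂ := ((tendsto_pi_nhds.1 ((hf.tendsto y).comp (hlim' i))) i).add hε
  rw [add_zero] at h₂
  exact le_of_tendsto_of_tendsto' h₁ h₂ fun N => hle (φ N) i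

/-- **Brouwer's fixed point theorem** for maps into a box. -/
theorem exists_fixed_point_of_mem_Icc {n : ℕ} {a b : Fin n → ℝ} {g : (Fin n → ℝ) → Fin n → ℝ}
    (hg : Continuous g) (hab : ∀ y, g y ∈ Set.Icc a b) : ∃ y, g y = y := by
  have hle : a ≤ b := (hab 0).1.trans (hab 0).2
  set L := ∑ i, (b i - a i) + 1 with hLdef
  have hL : 0 < L :=
    add_pos_of_nonneg_of_pos (Finset.sum_nonneg fun i _ => sub_nonneg.2 (hle i)) one_pos
  let u : (Option (Fin n) → ℝ) → Fin n → ℝ := fun x i => a i + L * x (some i)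
  let v : (Fin n → ℝ) → Option (Fin n) → ℝ := fun y o =>
    o.elim (1 - ∑ i, (y i - a i) / L) fun i => (y i - a i) / L
  have huv : ∀ y, u (v y) = y := fun y => funext fun i => by
    simp only [u, v, Option.elim_some]
    field_simp
    ring
  have hu : Continuous u := by fun_prop
  have hv : Continuous v := continuous_pi fun o => by
    cases o <;> simp only [v, Option.elim_none, Option.elim_some] <;> fun_prop
  obtain ⟨x, -, hx⟩ := exists_fixed_point_stdSimplex (hv.comp (hg.comp hu)) (by
    intro x _
    obtain ⟨h₁, h₂⟩ := hab (u x)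
    refine ⟨fun o => ?_, ?_⟩
    · cases o with
      | some i => exact div_nonneg (sub_nonneg.2 (h₁ i)) hL.le
      | none =>
        simp only [Function.comp_apply, v, Option.elim_none]
        rw [← Finset.sum_div, sub_nonneg, div_le_one hL, hLdef]
        have := Finset.sum_le_sum fun i (_ : i ∈ Finset.univ) => sub_le_sub_right (h₂ i) (a i)
        linarith
    · rw [Fintype.sum_option]
      simp [v])
  refine ⟨u x, ?_⟩
  rw [← huv (g (u x))]
  exact congrArg u hx

theorem ConvexOn.add_mul_sub_le_of_hasDerivAt {φ : ℝ → ℝ} (hφ : ConvexOn ℝ Set.univ φ) {x d : ℝ}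
    (hd : HasDerivAt φ d x) (t : ℝ) : φ x + d * (t - x) ≤ φ t := by
  rcases lt_trichotomy x t with h | rfl | h
  · have := hφ.le_slope_of_hasDerivAt (Set.mem_univ _) (Set.mem_univ _) h hd
    rw [slope_def_field, le_div_iff₀ (sub_pos.2 h)] at this
    linarith
  · simp
  · have := hφ.slope_le_of_hasDerivAt (Set.mem_univ _) (Set.mem_univ _) h hd
    rw [slope_def_field, div_le_iff₀ (sub_pos.2 h)] at this
    linarith

theorem IsMinOn.mul_sub_nonneg_of_hasDerivAt {φ : ℝ → ℝ} {s : Set ℝ} {x d t : ℝ}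
    (hmin : IsMinOn φ s x) (hs : Convex ℝ s) (hx : x ∈ s) (ht : t ∈ s) (hd : HasDerivAt φ d x) :
    0 ≤ d * (t - x) := by
  have := hmin.localize.hasFDerivWithinAt_nonneg hd.hasFDerivAt.hasFDerivWithinAt
    (sub_mem_posTangentConeAt_of_segment_subset (hs.segment_subset hx ht))
  simpa [mul_comm] using this

/-- The projected gradient step fixes only solutions of the variational inequality. -/
theorem mul_sub_nonneg_of_clamp_sub_eq {a b y d t : ℝ} (hab : a ≤ b)
    (h : max a (min b (y - d)) = y) (ht : t ∈ Set.Icc a b) : 0 ≤ d * (t - y) := by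
  obtain ⟨hat, htb⟩ := ht
  rcases le_total b (y - d) with h₁ | h₁
  · rw [min_eq_left h₁, max_eq_right hab] at h
    nlinarith
  · rw [min_eq_right h₁] at h
    rcases le_total a (y - d) with h₂ | h₂
    · rw [max_eq_right h₂] at h
      simp [show d = 0 by linarith]
    · rw [max_eq_left h₂] at h
      nlinarith

theorem exists_eq_Icc {s : Set ℝ} (hne : s.Nonempty) (hcp : IsCompact s) (hcv : Convex ℝ s) :
    ∃ a b, a ≤ b ∧ s = Set.Icc a b := by
  have h := eq_Icc_of_connected_compact ⟨hne, hcv.isPreconnected⟩ hcp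
  exact ⟨_, _, Set.nonempty_Icc.1 (h ▸ hne), h⟩

/-- with nonempty compact convex action sets and a continuous game mapping,
a Nash equilibrium exists, and every Nash equilibrium solves `VI(Ω, F)`. -/
theorem statement3 {n : ℕ} (Ω : Fin n → Set ℝ) (J : Fin n → (Fin n → ℝ) → ℝ)
    (F : (Fin n → ℝ) → Fin n → ℝ)
    (hΩne : ∀ i, (Ω i).Nonempty) (hΩcp : ∀ i, IsCompact (Ω i)) (hΩcv : ∀ i, Convex ℝ (Ω i))
    (hconv : ∀ (i : Fin n) (x : Fin n → ℝ),
      ConvexOn ℝ (Set.univ : Set ℝ) fun t : ℝ => J i (Function.update x i t))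
    (hder : ∀ (i : Fin n) (x : Fin n → ℝ),
      HasDerivAt (fun t : ℝ => J i (Function.update x i t)) (F x i) (x i))
    (hFcont : ∀ i : Fin n, Continuous fun x : Fin n → ℝ => F x i) :
    (∃ xs : Fin n → ℝ, IsNashEq Ω J xs) ∧
      ∀ xs : Fin n → ℝ, IsNashEq Ω J xs →
        ∀ x : Fin n → ℝ, (∀ i, x i ∈ Ω i) → 0 ≤ ∑ i, F xs i * (x i - xs i) := by
  choose a b hab hΩ using fun i => exists_eq_Icc (hΩne i) (hΩcp i) (hΩcv i)
  refine ⟨?_, fun xs hxs x hx => Finset.sum_nonneg fun i _ => ?_⟩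
  · obtain ⟨y, hy⟩ := exists_fixed_point_of_mem_Icc (a := a) (b := b)
      (g := fun y i => max (a i) (min (b i) (y i - F y i)))
      (continuous_pi fun i => continuous_const.max
        (continuous_const.min ((continuous_apply i).sub (hFcont i))))
      fun y => ⟨fun i => le_max_left _ _, fun i => max_le (hab i) (min_le_left _ _)⟩
    refine ⟨y, fun i => ?_, fun i t ht => ?_⟩
    · rw [hΩ, ← hy]
      exact ⟨le_max_left _ _, max_le (hab i) (min_le_left _ _)⟩
    · have h₁ := (hconv i y).add_mul_sub_le_of_hasDerivAt (hder i y) t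
      have h₂ := mul_sub_nonneg_of_clamp_sub_eq (hab i) (congrFun hy i) (hΩ i ▸ ht)
      rw [Function.update_eq_self] at h₁
      linarith
  · refine IsMinOn.mul_sub_nonneg_of_hasDerivAt (φ := fun t => J i (Function.update xs i t))
      (isMinOn_iff.2 fun t ht => ?_) (hΩcv i) (hxs.1 i) (hx i) (hder i xs)
    simpa using hxs.2 i t ht
end

section
/- Let Q be a nonempty closed convex subset of a Euclidean space, g : Q → Q's ambient space Lipschitz continuous on Q with constant L, and x* ∈ Q a point satisfying x* = P_Q(x* − λ g(x*)) for the given λ > 0 (equivalently, x* solves VI(Q, g)). If g is restricted strongly monotone with respect to x* with constant μ_r > 0, i.e. ⟨g(x) − g(x*), x − x*⟩ ≥ μ_r ‖x − x*‖² for all x ∈ Q, then for every x ∈ Q, ‖P_Q(x − λ g(x)) − x*‖² ≤ (1 + L²λ² − 2 μ_r λ) ‖x − x*‖². -/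
open scoped RealInnerProductSpace

section NearestPoint

variable {E : Type*} [NormedAddCommGroup E] [InnerProductSpace ℝ E]

/-- The variational characterization of a nearest point of a convex set. -/
theorem inner_sub_nearest_le_zero {Q : Set E} (hQ : Convex ℝ Q) {z p : E} (hp : p ∈ Q)
    (hmin : ∀ y ∈ Q, ‖z - p‖ ≤ ‖z - y‖) : ∀ y ∈ Q, ⟪z - p, y - p⟫ ≤ 0 := by
  refine (norm_eq_iInf_iff_real_inner_le_zero hQ hp).1 (le_antisymm ?_ ?_)
  · have : Nonempty Q := ⟨⟨p, hp⟩⟩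
    exact le_ciInf fun y => hmin y y.2
  · exact ciInf_le ⟨0, by rintro _ ⟨y, rfl⟩; exact norm_nonneg _⟩ (⟨p, hp⟩ : Q)

/-- Nearest points of a convex set depend nonexpansively on the projected point. -/
theorem norm_nearest_sub_nearest_le {Q : Set E} (hQ : Convex ℝ Q) {z w p q : E}
    (hp : p ∈ Q) (hpmin : ∀ y ∈ Q, ‖z - p‖ ≤ ‖z - y‖)
    (hq : q ∈ Q) (hqmin : ∀ y ∈ Q, ‖w - q‖ ≤ ‖w - y‖) : ‖p - q‖ ≤ ‖z - w‖ := by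
  have h₁ := inner_sub_nearest_le_zero hQ hp hpmin q hq
  have h₂ := inner_sub_nearest_le_zero hQ hq hqmin p hp
  have hexp : ⟪z - w, p - q⟫ = ‖p - q‖ ^ 2 - ⟪z - p, q - p⟫ - ⟪w - q, p - q⟫ := by
    rw [← real_inner_self_eq_norm_sq, ← neg_sub p q, inner_neg_right, sub_neg_eq_add,
      ← inner_add_left, ← inner_sub_left]
    congr 1
    abel
  have hcs := real_inner_le_norm (z - w) (p - q)
  nlinarith [norm_nonneg (p - q), norm_nonneg (z - w)]

end NearestPoint

/-- one-step contraction of the projected gradient map for a Lipschitz,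
restricted strongly monotone operator `g` over a nonempty closed convex set `Q` in a
Euclidean space, around a fixed point `x*` of the projected gradient map (a solution of
`VI(Q, g)`). Here `P` is the nearest-point projection onto `Q`. -/
theorem statement17 {d : ℕ} (Q : Set (EuclideanSpace ℝ (Fin d)))
    (hQne : Q.Nonempty) (hQcl : IsClosed Q) (hQcv : Convex ℝ Q)
    (g : EuclideanSpace ℝ (Fin d) → EuclideanSpace ℝ (Fin d))
    (L : ℝ) (hlip : ∀ u ∈ Q, ∀ v ∈ Q, ‖g u - g v‖ ≤ L * ‖u - v‖)
    (P : EuclideanSpace ℝ (Fin d) → EuclideanSpace ℝ (Fin d))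
    (hP : ∀ z, P z ∈ Q ∧ ∀ y ∈ Q, ‖z - P z‖ ≤ ‖z - y‖)
    (lam : ℝ) (hlam : 0 < lam)
    (xs : EuclideanSpace ℝ (Fin d)) (hxsQ : xs ∈ Q)
    (hfix : xs = P (xs - lam • g xs))
    (μr : ℝ) (hμr : 0 < μr)
    (hrmono : ∀ x ∈ Q, μr * ‖x - xs‖ ^ 2 ≤ ⟪g x - g xs, x - xs⟫) :
    ∀ x ∈ Q, ‖P (x - lam • g x) - xs‖ ^ 2 ≤ (1 + L ^ 2 * lam ^ 2 - 2 * μr * lam) * ‖x - xs‖ ^ 2 := by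
  intro x hx
  have hproj : ‖P (x - lam • g x) - xs‖ ≤ ‖(x - lam • g x) - (xs - lam • g xs)‖ := by
    have h := norm_nearest_sub_nearest_le hQcv (hP (x - lam • g x)).1 (hP (x - lam • g x)).2
      (hP (xs - lam • g xs)).1 (hP (xs - lam • g xs)).2
    rwa [← hfix] at h
  have hexp : ‖(x - lam • g x) - (xs - lam • g xs)‖ ^ 2 =
      ‖x - xs‖ ^ 2 - 2 * lam * ⟪g x - g xs, x - xs⟫ + lam ^ 2 * ‖g x - g xs‖ ^ 2 := by
    have hsub : (x - lam • g x) - (xs - lam • g xs) = (x - xs) - lam • (g x - g xs) := by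
      rw [smul_sub]
      abel
    rw [hsub, norm_sub_sq_real, inner_smul_right, norm_smul, mul_pow, Real.norm_eq_abs, sq_abs,
      real_inner_comm]
    ring
  have hlip_sq : ‖g x - g xs‖ ^ 2 ≤ (L * ‖x - xs‖) ^ 2 :=
    pow_le_pow_left₀ (norm_nonneg _) (hlip x hx xs hxsQ) 2
  calc ‖P (x - lam • g x) - xs‖ ^ 2
      ≤ ‖(x - lam • g x) - (xs - lam • g xs)‖ ^ 2 := pow_le_pow_left₀ (norm_nonneg _) hproj 2
    _ ≤ (1 + L ^ 2 * lam ^ 2 - 2 * μr * lam) * ‖x - xs‖ ^ 2 := by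
      rw [hexp]
      linarith [mul_le_mul_of_nonneg_left hlip_sq (sq_nonneg lam),
        mul_le_mul_of_nonneg_left (hrmono x hx) hlam.le]
end
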